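/- Let D be a division ring whose center F is infinite, let f(x_1,…,x_m) be a multilinear polynomial over F that is non-central over M_2(F), and let d be a positive integer. If for all nonzero a_1,…,a_m ∈ D the value f(a_1,…,a_m) is algebraic over F of degree at most d, then dim_F D ≤ d². -/

import Mathlib

/-- Evaluation of the multilinear polynomial
`f(x_1,…,x_m) = ∑_{σ ∈ S_m} c σ • x_{σ(1)} x_{σ(2)} ⋯ x_{σ(m)}`
(given by its coefficient family `c`) at the tuple `T` in an `F`-algebra `R`. -/
def mlEval {F : Type*} [CommSemiring F] {m : ℕ} (c : Equiv.Perm (Fin m) → F)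
    {R : Type*} [Ring R] [Algebra F R] (T : Fin m → R) : R :=
  ∑ σ : Equiv.Perm (Fin m), c σ • (List.ofFn fun i => T (σ i)).prod

/-! ### Basic facts on `mlEval` -/

theorem mlEval_map {F : Type*} [CommRing F] {m : ℕ} (c : Equiv.Perm (Fin m) → F)
    {R S : Type*} [Ring R] [Algebra F R] [Ring S] [Algebra F S] (φ : R →ₐ[F] S)
    (T : Fin m → R) : φ (mlEval c T) = mlEval c (fun i => φ (T i)) := by
  simp only [mlEval, map_sum, map_smul, map_list_prod, List.map_ofFn]
  rfl

theorem mlEval_tower {F K : Type*} [Field F] [Field K] [Algebra F K] {m : ℕ}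
    (c : Equiv.Perm (Fin m) → F) {R : Type*} [Ring R] [Algebra F R] [Algebra K R]
    [IsScalarTower F K R] (T : Fin m → R) :
    mlEval (fun σ => algebraMap F K (c σ)) T = mlEval c T := by
  simp only [mlEval, algebraMap_smul]

/-- `mlEval` as a multilinear map. -/
noncomputable def mlMap {F : Type*} [CommRing F] {m : ℕ} (c : Equiv.Perm (Fin m) → F)
    (R : Type*) [Ring R] [Algebra F R] : MultilinearMap F (fun _ : Fin m => R) R :=
  ∑ σ : Equiv.Perm (Fin m), c σ • (MultilinearMap.mkPiAlgebraFin F m R).domDomCongr σ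

theorem mlMap_apply {F : Type*} [CommRing F] {m : ℕ} (c : Equiv.Perm (Fin m) → F)
    {R : Type*} [Ring R] [Algebra F R] (T : Fin m → R) : mlMap c R T = mlEval c T := by
  simp [mlMap, mlEval, MultilinearMap.mkPiAlgebraFin_apply]

theorem mlEval_smul {F : Type*} [CommRing F] {m : ℕ} (c : Equiv.Perm (Fin m) → F)
    {R : Type*} [Ring R] [Algebra F R] (s : F) (T : Fin m → R) :
    mlEval c (fun i => s • T i) = s ^ m • mlEval c T := by
  rw [← mlMap_apply, ← mlMap_apply]
  have := (mlMap c R).map_smul_univ (fun _ => s) T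
  simpa using this

theorem mlEval_zero_of {F : Type*} [CommRing F] {m : ℕ} (c : Equiv.Perm (Fin m) → F)
    {R : Type*} [Ring R] [Algebra F R] (T : Fin m → R) (i : Fin m) (h : T i = 0) :
    mlEval c T = 0 := by
  rw [← mlMap_apply]
  exact (mlMap c R).map_coord_zero i h

/-! ### Parity for `2 × 2` matrices -/

/-- `M` is diagonal (`e = 0`) or antidiagonal (`e = 1`). -/
def Par {K : Type*} [CommRing K] (e : Fin 2) (M : Matrix (Fin 2) (Fin 2) K) : Prop :=
  ∀ i j, i + j ≠ e → M i j = 0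

theorem Par.mul {K : Type*} [CommRing K] {e e' : Fin 2} {M N : Matrix (Fin 2) (Fin 2) K}
    (hM : Par e M) (hN : Par e' N) : Par (e + e') (M * N) := by
  intro i j hij
  rw [Matrix.mul_apply]
  refine Finset.sum_eq_zero fun k _ => ?_
  by_cases h1 : i + k = e
  · have : k + j ≠ e' := by
      rintro rfl
      apply hij
      subst h1
      clear hM hN hij
      have : ∀ i j k : Fin 2, i + j = i + k + (k + j) := by decide
      exact this i j k
    rw [hN _ _ this, mul_zero]
  · rw [hM _ _ h1, zero_mul]

theorem Par.add {K : Type*} [CommRing K] {e : Fin 2} {M N : Matrix (Fin 2) (Fin 2) K}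
    (hM : Par e M) (hN : Par e N) : Par e (M + N) := by
  intro i j hij
  rw [Matrix.add_apply, hM _ _ hij, hN _ _ hij, add_zero]

theorem Par.smul {K : Type*} [CommRing K] {e : Fin 2} {M : Matrix (Fin 2) (Fin 2) K}
    (s : K) (hM : Par e M) : Par e (s • M) := by
  intro i j hij
  rw [Matrix.smul_apply, hM _ _ hij, smul_zero]

theorem Par.list {K : Type*} [CommRing K] {m : ℕ} (e : Fin m → Fin 2)
    (T : Fin m → Matrix (Fin 2) (Fin 2) K) (h : ∀ i, Par (e i) (T i)) :
    Par (∑ i, e i) (List.ofFn T).prod := by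
  induction m with
  | zero =>
    intro i j hij
    have : i ≠ j := by
      rintro rfl
      apply hij
      have h2 : ∀ i : Fin 2, i + i = 0 := by decide
      rw [h2]; simp
    simp [this]
  | succ m ih =>
    rw [List.ofFn_succ, List.prod_cons, Fin.sum_univ_succ]
    exact (h 0).mul (ih _ _ fun i => h _)

theorem Par.mlEval {K : Type*} [CommRing K] {m : ℕ} (c : Equiv.Perm (Fin m) → K)
    (e : Fin m → Fin 2) (T : Fin m → Matrix (Fin 2) (Fin 2) K) (h : ∀ i, Par (e i) (T i)) :
    Par (∑ i, e i) (mlEval c T) := by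
  intro i j hij
  unfold _root_.mlEval
  rw [Matrix.sum_apply]
  refine Finset.sum_eq_zero fun σ _ => ?_
  have := (Par.list (fun i => e (σ i)) (fun i => T (σ i)) fun i => h _).smul (c σ)
  rw [Equiv.sum_comp σ e] at this
  exact this i j hij

/-- The flip of a `2 × 2` matrix. -/
def flipM (K : Type*) [CommRing K] :
    Matrix (Fin 2) (Fin 2) K ≃ₐ[K] Matrix (Fin 2) (Fin 2) K :=
  Matrix.reindexAlgEquiv K K (Equiv.swap (0 : Fin 2) 1)

theorem flipM_apply {K : Type*} [CommRing K] (M : Matrix (Fin 2) (Fin 2) K) (i j : Fin 2) :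
    flipM K M i j = M (i + 1) (j + 1) := by
  fin_cases i <;> fin_cases j <;> simp [flipM]

theorem Par.flip {K : Type*} [CommRing K] {e : Fin 2} {M : Matrix (Fin 2) (Fin 2) K}
    (hM : Par e M) : Par e (flipM K M) := by
  intro i j hij
  rw [flipM_apply]
  apply hM
  have h2 : ∀ i j e : Fin 2, i + j ≠ e → i + 1 + (j + 1) ≠ e := by decide
  exact h2 i j e hij

/-- A noncentral multilinear polynomial takes an invertible nonscalar value on `2 × 2` matrices. -/
theorem exists_good_two {K : Type*} [Field K] [Infinite K] {m : ℕ}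
    (c : Equiv.Perm (Fin m) → K)
    (hf : ¬ ∀ T : Fin m → Matrix (Fin 2) (Fin 2) K, ∃ a : K,
      mlEval c T = a • (1 : Matrix (Fin 2) (Fin 2) K)) :
    ∃ T : Fin m → Matrix (Fin 2) (Fin 2) K, (mlEval c T).det ≠ 0 ∧
      ¬ ∃ a : K, mlEval c T = a • (1 : Matrix (Fin 2) (Fin 2) K) := by
  classical
  obtain ⟨e, T, hT, hns⟩ : ∃ (e : Fin m → Fin 2) (T : Fin m → Matrix (Fin 2) (Fin 2) K),
      (∀ i, Par (e i) (T i)) ∧ ¬ ∃ a : K, mlEval c T = a • (1 : Matrix (Fin 2) (Fin 2) K) := by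
    by_contra hcon
    push Not at hcon
    apply hf
    intro T
    let Td : Fin m → Matrix (Fin 2) (Fin 2) K := fun i => Matrix.of fun a b =>
      if a + b = 0 then T i a b else 0
    let To : Fin m → Matrix (Fin 2) (Fin 2) K := fun i => Matrix.of fun a b =>
      if a + b = 1 then T i a b else 0
    have hTT : T = Td + To := by
      ext i a b
      fin_cases a <;> fin_cases b <;> simp [Td, To]
    have key : ∀ s : Finset (Fin m), ∃ a : K,
        mlEval c (s.piecewise Td To) = a • (1 : Matrix (Fin 2) (Fin 2) K) := by
      intro s
      apply hcon (fun i => if i ∈ s then 0 else 1)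
      intro i
      by_cases hi : i ∈ s
      · simp only [hi, if_true, Finset.piecewise_eq_of_mem]
        intro a b hab
        simp [Td, hab]
      · simp only [hi, if_false, not_false_eq_true, Finset.piecewise_eq_of_notMem]
        intro a b hab
        simp [To, hab]
    choose g hg using key
    refine ⟨∑ s, g s, ?_⟩
    rw [hTT, ← mlMap_apply, MultilinearMap.map_add_univ, Finset.sum_smul]
    refine Finset.sum_congr rfl fun s _ => ?_
    rw [mlMap_apply, hg]
  set ε := ∑ i, e i with hε
  let P := MvPolynomial (Fin 2) K
  let G : Matrix (Fin 2) (Fin 2) P := mlEval c (R := Matrix (Fin 2) (Fin 2) P) (fun i =>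
    (MvPolynomial.X 0 : P) • (T i).map (algebraMap K P) +
      (MvPolynomial.X 1 : P) • (flipM K (T i)).map (algebraMap K P))
  let W : (Fin 2 → K) → Fin m → Matrix (Fin 2) (Fin 2) K := fun s i =>
    s 0 • T i + s 1 • flipM K (T i)
  have hev : ∀ s i j, MvPolynomial.eval s (G i j) = mlEval c (W s) i j := by
    intro s i j
    have h1 := mlEval_map c (AlgHom.mapMatrix (m := Fin 2) (MvPolynomial.aeval (R := K) s)) (fun i =>
      (MvPolynomial.X 0 : P) • (T i).map (algebraMap K P) +
        (MvPolynomial.X 1 : P) • (flipM K (T i)).map (algebraMap K P))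
    have h2 := congrFun (congrFun h1 i) j
    rw [AlgHom.mapMatrix_apply, Matrix.map_apply] at h2
    rw [← MvPolynomial.coe_aeval_eq_eval]
    refine h2.trans ?_
    have h3 : (fun i => (AlgHom.mapMatrix (m := Fin 2) (MvPolynomial.aeval (R := K) s))
        ((MvPolynomial.X 0 : P) • (T i).map (algebraMap K P) +
        (MvPolynomial.X 1 : P) • (flipM K (T i)).map (algebraMap K P))) = W s := by
      funext k
      ext a b
      simp [W, P]
    rw [h3]
  have hpar : ∀ s, Par ε (mlEval c (W s)) := fun s =>
    Par.mlEval c e _ fun i => ((hT i).smul _).add ((hT i).flip.smul _)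
  have hW10 : mlEval c (W ![1, 0]) = mlEval c T := by
    congr 1; funext i; simp [W]
  have hW01 : mlEval c (W ![0, 1]) = flipM K (mlEval c T) := by
    have := mlEval_map c (flipM K).toAlgHom T
    refine Eq.trans ?_ this.symm
    congr 1; funext i; simp [W]
  have hp0 := hpar ![1, 0]
  rw [hW10] at hp0
  have hp : ∀ i j, G i j ≠ 0 ↔ ∃ s, mlEval c (W s) i j ≠ 0 := by
    intro i j
    constructor
    · intro h
      by_contra hcon
      push Not at hcon
      apply h
      apply MvPolynomial.funext
      intro s
      rw [hev, hcon, map_zero]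
    · rintro ⟨s, hs⟩ h
      rw [← hev, h, map_zero] at hs
      exact hs rfl
  have hfin : ε = 0 ∨ ε = 1 := by
    generalize ε = x; revert x; decide
  have nz : ∀ Q : P, Q ≠ 0 → ∃ s, MvPolynomial.eval s Q ≠ 0 := by
    intro Q hQ
    by_contra hcon
    push Not at hcon
    exact hQ (MvPolynomial.funext fun s => by rw [hcon, map_zero])
  rcases hfin with h0 | h0 <;> rw [h0] at hp0 hpar
  · have e01 := hp0 0 1 (by decide)
    have e10 := hp0 1 0 (by decide)
    have hne : mlEval c T 0 0 ≠ mlEval c T 1 1 := by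
      intro h
      apply hns
      refine ⟨mlEval c T 0 0, ?_⟩
      ext i j
      fin_cases i <;> fin_cases j <;> simp [e01, e10, h]
    have hor : mlEval c T 0 0 ≠ 0 ∨ mlEval c T 1 1 ≠ 0 := by
      by_contra hcon
      push Not at hcon
      exact hne (hcon.1.trans hcon.2.symm)
    have g00 : G 0 0 ≠ 0 := by
      rw [hp]
      rcases hor with h | h
      · exact ⟨_, by rw [hW10]; exact h⟩
      · exact ⟨_, by rw [hW01, flipM_apply]; exact h⟩
    have g11 : G 1 1 ≠ 0 := by
      rw [hp]
      rcases hor with h | h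
      · exact ⟨_, by rw [hW01, flipM_apply]; exact h⟩
      · exact ⟨_, by rw [hW10]; exact h⟩
    have g01 : G 0 0 - G 1 1 ≠ 0 := by
      intro h
      apply hne
      rw [← hW10, ← hev, ← hev, sub_eq_zero.mp h]
    obtain ⟨s, hs⟩ := nz _ (mul_ne_zero (mul_ne_zero g00 g11) g01)
    simp only [map_mul, map_sub, hev] at hs
    have f01 := hpar s 0 1 (by decide)
    have f10 := hpar s 1 0 (by decide)
    refine ⟨W s, ?_, ?_⟩
    · rw [Matrix.det_fin_two, f01]
      simpa using left_ne_zero_of_mul hs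
    · rintro ⟨a, ha⟩
      apply right_ne_zero_of_mul hs
      rw [ha]; simp
  · have e00 := hp0 0 0 (by decide)
    have e11 := hp0 1 1 (by decide)
    have hor : mlEval c T 0 1 ≠ 0 ∨ mlEval c T 1 0 ≠ 0 := by
      by_contra hcon
      push Not at hcon
      apply hns
      refine ⟨0, ?_⟩
      ext i j
      fin_cases i <;> fin_cases j <;> simp [e00, e11, hcon.1, hcon.2]
    have g01 : G 0 1 ≠ 0 := by
      rw [hp]
      rcases hor with h | h
      · exact ⟨_, by rw [hW10]; exact h⟩
      · exact ⟨_, by rw [hW01, flipM_apply]; exact h⟩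
    have g10 : G 1 0 ≠ 0 := by
      rw [hp]
      rcases hor with h | h
      · exact ⟨_, by rw [hW01, flipM_apply]; exact h⟩
      · exact ⟨_, by rw [hW10]; exact h⟩
    obtain ⟨s, hs⟩ := nz _ (mul_ne_zero g01 g10)
    simp only [map_mul, hev] at hs
    have f00 := hpar s 0 0 (by decide)
    refine ⟨W s, ?_, ?_⟩
    · rw [Matrix.det_fin_two, f00]
      simpa using hs
    · rintro ⟨a, ha⟩
      apply left_ne_zero_of_mul hs
      rw [ha]; simp

/-! ### Block diagonal constructions -/

/-- Block diagonal embedding as an algebra map. -/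
def blockHom (K : Type*) [Field K] (ι κ : Type*) [Fintype ι] [Fintype κ] [DecidableEq ι]
    [DecidableEq κ] :
    (Matrix ι ι K × Matrix κ κ K) →ₐ[K] Matrix (ι ⊕ κ) (ι ⊕ κ) K where
  toFun x := Matrix.fromBlocks x.1 0 0 x.2
  map_one' := by simp
  map_mul' x y := by simp [Matrix.fromBlocks_multiply]
  map_zero' := by simp
  map_add' x y := by simp [Matrix.fromBlocks_add]
  commutes' r := by
    simp only [Algebra.algebraMap_eq_smul_one, Prod.smul_fst, Prod.smul_snd, Prod.fst_one,
      Prod.snd_one]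
    rw [← Matrix.fromBlocks_one, Matrix.fromBlocks_smul]
    simp

theorem mlEval_block {K : Type*} [Field K] {ι κ : Type*} [Fintype ι] [Fintype κ]
    [DecidableEq ι] [DecidableEq κ] {m : ℕ} (c : Equiv.Perm (Fin m) → K)
    (A : Fin m → Matrix ι ι K) (B : Fin m → Matrix κ κ K) :
    mlEval c (fun i => Matrix.fromBlocks (A i) 0 0 (B i)) =
      Matrix.fromBlocks (mlEval c A) 0 0 (mlEval c B) := by
  have h := mlEval_map c (blockHom K ι κ) (fun i => (A i, B i))
  have h1 := mlEval_map c (AlgHom.fst K (Matrix ι ι K) (Matrix κ κ K)) (fun i => (A i, B i))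
  have h2 := mlEval_map c (AlgHom.snd K (Matrix ι ι K) (Matrix κ κ K)) (fun i => (A i, B i))
  refine Eq.trans h.symm ?_
  change Matrix.fromBlocks _ 0 0 _ = _
  congr 1

theorem aeval_block {K : Type*} [Field K] {ι κ : Type*} [Fintype ι] [Fintype κ]
    [DecidableEq ι] [DecidableEq κ] (A : Matrix ι ι K) (B : Matrix κ κ K)
    (q : Polynomial K) (h : Polynomial.aeval (Matrix.fromBlocks A 0 0 B) q = 0) :
    Polynomial.aeval A q = 0 ∧ Polynomial.aeval B q = 0 := by
  have h0 : Polynomial.aeval (blockHom K ι κ (A, B)) q = 0 := h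
  rw [Polynomial.aeval_algHom_apply] at h0
  have h1 : Polynomial.aeval (A, B) q = 0 := by
    have h2 : Matrix.fromBlocks (Polynomial.aeval (A, B) q).1 0 0 (Polynomial.aeval (A, B) q).2
      = 0 := h0
    rw [← Matrix.fromBlocks_zero, Matrix.fromBlocks_inj] at h2
    exact Prod.ext h2.1 h2.2.2.2
  have h3 := Polynomial.aeval_algHom_apply (AlgHom.fst K (Matrix ι ι K) (Matrix κ κ K)) (A, B) q
  have h4 := Polynomial.aeval_algHom_apply (AlgHom.snd K (Matrix ι ι K) (Matrix κ κ K)) (A, B) q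
  rw [h1, map_zero] at h3 h4
  exact ⟨h3, h4⟩

/-- Any polynomial killing a nonscalar `2 × 2` matrix is divisible by its characteristic
polynomial. -/
theorem charpoly_dvd_of_two {K : Type*} [Field K] (C : Matrix (Fin 2) (Fin 2) K)
    (hC : ¬ ∃ a : K, C = a • (1 : Matrix (Fin 2) (Fin 2) K)) (q : Polynomial K)
    (hq : Polynomial.aeval C q = 0) : C.charpoly ∣ q := by
  have hm := Matrix.charpoly_monic C
  rw [← Polynomial.modByMonic_eq_zero_iff_dvd hm]
  set r := q %ₘ C.charpoly with hr
  have hr0 : Polynomial.aeval C r = 0 := by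
    have := Polynomial.modByMonic_add_div q C.charpoly
    rw [← this] at hq
    simpa [Matrix.aeval_self_charpoly] using hq
  have hdeg : r.degree < 2 := by
    have := Polynomial.degree_modByMonic_lt q hm
    rwa [Matrix.charpoly_degree_eq_dim] at this
  have hd1 : r.natDegree ≤ 1 := by
    by_cases h : r = 0
    · simp [h]
    · have := (Polynomial.natDegree_lt_iff_degree_lt h (n := 2)).mpr hdeg
      omega
  obtain ⟨a, b, hab⟩ := Polynomial.exists_eq_X_add_C_of_natDegree_le_one hd1
  rw [hab] at hr0
  simp only [map_add, map_mul, Polynomial.aeval_C, Polynomial.aeval_X,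
    Algebra.algebraMap_eq_smul_one, smul_mul_assoc, one_mul] at hr0
  have ha : a = 0 := by
    by_contra ha
    apply hC
    refine ⟨-(a⁻¹ * b), ?_⟩
    have : C = a⁻¹ • (a • C) := by rw [smul_smul, inv_mul_cancel₀ ha, one_smul]
    rw [this, eq_neg_of_add_eq_zero_left hr0]
    rw [smul_neg, smul_smul, neg_smul]
  have hb : b = 0 := by
    rw [ha, zero_smul, zero_add] at hr0
    simpa using congrFun (congrFun hr0 0) 0
  rw [hab, ha, hb]; simp

theorem exists_scale {K : Type*} [Field K] [Infinite K] {ι : Type*} [Fintype ι]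
    [DecidableEq ι] (B : Matrix ι ι K) (p : Polynomial K) (hp : p.eval 0 ≠ 0) (m : ℕ)
    (hm : 0 < m) :
    ∃ s : K, s ≠ 0 ∧ (Polynomial.aeval (s ^ m • B) p).det ≠ 0 := by
  let M : Matrix ι ι (Polynomial K) :=
    Polynomial.aeval ((Polynomial.X ^ m : Polynomial K) • B.map (algebraMap K (Polynomial K))) p
  have hev : ∀ s : K, M.det.eval s = (Polynomial.aeval (s ^ m • B) p).det := by
    intro s
    rw [← Polynomial.coe_aeval_eq_eval, AlgHom.map_det]
    congr 1
    have := Polynomial.aeval_algHom_apply (AlgHom.mapMatrix (m := ι)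
      (Polynomial.aeval (R := K) s))
      ((Polynomial.X ^ m : Polynomial K) • B.map (algebraMap K (Polynomial K))) p
    refine this.symm.trans ?_
    congr 2
    ext a b
    simp
    exact mul_comm _ _
  have h0 : M.det.eval 0 ≠ 0 := by
    rw [hev, zero_pow hm.ne', zero_smul]
    have : Polynomial.aeval (0 : Matrix ι ι K) p = algebraMap K _ (p.eval 0) := by
      have h := Polynomial.aeval_algebraMap_apply (Matrix ι ι K) (0 : K) p
      rw [map_zero] at h
      rw [h, Polynomial.coe_aeval_eq_eval]
    rw [this, Algebra.algebraMap_eq_smul_one, Matrix.det_smul, Matrix.det_one, mul_one]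
    exact pow_ne_zero _ hp
  have hX : M.det * Polynomial.X ≠ 0 := by
    apply mul_ne_zero _ Polynomial.X_ne_zero
    intro h
    rw [h] at h0
    simp at h0
  obtain ⟨s, hs⟩ : ∃ s, (M.det * Polynomial.X).eval s ≠ 0 := by
    by_contra hcon
    push Not at hcon
    exact hX (Polynomial.funext fun s => by rw [hcon]; simp)
  rw [Polynomial.eval_mul, Polynomial.eval_X, hev] at hs
  exact ⟨s, right_ne_zero_of_mul hs, left_ne_zero_of_mul hs⟩

theorem exists_good_even {K : Type*} [Field K] [Infinite K] {m : ℕ} (hm : 0 < m)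
    (c : Equiv.Perm (Fin m) → K)
    (hf : ¬ ∀ T : Fin m → Matrix (Fin 2) (Fin 2) K, ∃ a : K,
      mlEval c T = a • (1 : Matrix (Fin 2) (Fin 2) K)) (k : ℕ) :
    ∃ (ι : Type) (_ : Fintype ι) (_ : DecidableEq ι) (A : Fin m → Matrix ι ι K),
      Fintype.card ι = 2 * k ∧ (mlEval c A).det ≠ 0 ∧
      ∀ q : Polynomial K, q ≠ 0 → Polynomial.aeval (mlEval c A) q = 0 →
        2 * k ≤ q.natDegree := by
  induction k with
  | zero =>
    refine ⟨Empty, inferInstance, inferInstance, fun _ => 0, rfl, ?_, ?_⟩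
    · rw [Matrix.det_isEmpty]; exact one_ne_zero
    · intro q _ _; simp
  | succ k ih =>
    obtain ⟨ι, _, _, A, hcard, hdet, hq⟩ := ih
    obtain ⟨T, hT, hTn⟩ := exists_good_two c hf
    set C := mlEval c T with hC
    set B := mlEval c A with hB
    have hC0 : C.charpoly.eval 0 ≠ 0 := by
      rw [Matrix.charpoly_fin_two]; simpa using hT
    obtain ⟨s, hs0, hs⟩ := exists_scale B C.charpoly hC0 m hm
    have hval : mlEval c (fun i => Matrix.fromBlocks (s • A i) 0 0 (T i)) =
        Matrix.fromBlocks (s ^ m • B) 0 0 C := by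
      rw [mlEval_block, mlEval_smul]
    refine ⟨ι ⊕ Fin 2, inferInstance, inferInstance,
      fun i => Matrix.fromBlocks (s • A i) 0 0 (T i), ?_, ?_, ?_⟩
    · simp [hcard]; ring
    · rw [hval, Matrix.det_fromBlocks_zero₂₁, Matrix.det_smul]
      exact mul_ne_zero (mul_ne_zero (pow_ne_zero _ (pow_ne_zero _ hs0)) hdet) hT
    · intro q hq0 hqv
      rw [hval] at hqv
      obtain ⟨h1, h2⟩ := aeval_block _ _ _ hqv
      obtain ⟨q', rfl⟩ := charpoly_dvd_of_two C hTn q h2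
      have hq'0 : q' ≠ 0 := right_ne_zero_of_mul hq0
      rw [map_mul] at h1
      have hu : IsUnit (Polynomial.aeval (s ^ m • B) C.charpoly) :=
        (Matrix.isUnit_iff_isUnit_det _).mpr (isUnit_iff_ne_zero.mpr hs)
      have h3 : Polynomial.aeval (s ^ m • B) q' = 0 := by
        exact (hu.mul_right_eq_zero).mp h1
      have h4 : Polynomial.aeval B (q'.comp (Polynomial.C (s ^ m) * Polynomial.X)) = 0 := by
        rw [Polynomial.aeval_comp]
        rw [map_mul, Polynomial.aeval_C, Polynomial.aeval_X, ← Algebra.smul_def]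
        exact h3
      have hnd : (Polynomial.C (s ^ m) * Polynomial.X : Polynomial K).natDegree = 1 :=
        Polynomial.natDegree_C_mul_X _ (pow_ne_zero _ hs0)
      have h5 : q'.comp (Polynomial.C (s ^ m) * Polynomial.X) ≠ 0 := by
        intro h
        rw [Polynomial.comp_eq_zero_iff] at h
        rcases h with h | ⟨_, h⟩
        · exact hq'0 h
        · rw [h] at hnd; simp at hnd
      have h6 := hq _ h5 h4
      rw [Polynomial.natDegree_comp, hnd, mul_one] at h6
      rw [Polynomial.natDegree_mul (Matrix.charpoly_monic C).ne_zero hq'0,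
        Matrix.charpoly_natDegree_eq_dim]
      simp only [Fintype.card_fin]
      omega

theorem exists_good {K : Type*} [Field K] [Infinite K] {m : ℕ} (hm : 0 < m)
    (c : Equiv.Perm (Fin m) → K)
    (hf : ¬ ∀ T : Fin m → Matrix (Fin 2) (Fin 2) K, ∃ a : K,
      mlEval c T = a • (1 : Matrix (Fin 2) (Fin 2) K)) (n : ℕ) :
    ∃ (ι : Type) (_ : Fintype ι) (_ : DecidableEq ι) (A : Fin m → Matrix ι ι K),
      Fintype.card ι = n ∧
      ∀ q : Polynomial K, q ≠ 0 → Polynomial.aeval (mlEval c A) q = 0 →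
        n ≤ q.natDegree := by
  rcases Nat.even_or_odd' n with ⟨k, rfl | rfl⟩
  · obtain ⟨ι, i1, i2, A, h1, _, h3⟩ := exists_good_even hm c hf k
    exact ⟨ι, i1, i2, A, h1, h3⟩
  · obtain ⟨ι, i1, i2, A, h1, h2, h3⟩ := exists_good_even hm c hf k
    refine ⟨ι ⊕ Unit, inferInstance, inferInstance, fun i => Matrix.fromBlocks (A i) 0 0 0,
      by simp [h1], ?_⟩
    intro q hq0 hq
    rw [mlEval_block c A (fun _ => (0 : Matrix Unit Unit K)),
      mlEval_zero_of c (fun _ => (0 : Matrix Unit Unit K)) ⟨0, hm⟩ rfl] at hq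
    obtain ⟨e1, e2⟩ := aeval_block _ _ _ hq
    have hev : q.eval 0 = 0 := by
      have h := Polynomial.aeval_algebraMap_apply (Matrix Unit Unit K) (0 : K) q
      rw [map_zero, e2, Polynomial.coe_aeval_eq_eval] at h
      simpa [Algebra.algebraMap_eq_smul_one] using (congrFun (congrFun h ()) ()).symm
    obtain ⟨q', rfl⟩ : Polynomial.X ∣ q := by
      rw [Polynomial.X_dvd_iff, Polynomial.coeff_zero_eq_eval_zero, hev]
    have hq'0 : q' ≠ 0 := right_ne_zero_of_mul hq0
    rw [map_mul, Polynomial.aeval_X] at e1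
    have hu : IsUnit (mlEval c A) :=
      (Matrix.isUnit_iff_isUnit_det _).mpr (isUnit_iff_ne_zero.mpr h2)
    have h4 := h3 q' hq'0 ((hu.mul_right_eq_zero).mp e1)
    rw [Polynomial.natDegree_X_mul hq'0]
    omega

/-! ### Polynomial functions with values in an algebra -/

/-- All linear functionals of `E` are polynomial functions. -/
def PolyFun {K : Type*} [Field K] {τ 𝓔 : Type*} [Ring 𝓔] [Algebra K 𝓔]
    (E : (τ → K) → 𝓔) : Prop :=
  ∀ Λ : 𝓔 →ₗ[K] K, ∃ p : MvPolynomial τ K, ∀ t, MvPolynomial.eval t p = Λ (E t)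

theorem PolyFun.add {K : Type*} [Field K] {τ 𝓔 : Type*} [Ring 𝓔] [Algebra K 𝓔]
    {E G : (τ → K) → 𝓔} (hE : PolyFun E) (hG : PolyFun G) : PolyFun (E + G) := by
  intro Λ
  obtain ⟨p, hp⟩ := hE Λ
  obtain ⟨q, hq⟩ := hG Λ
  exact ⟨p + q, fun t => by simp [hp, hq]⟩

theorem PolyFun.const_mul {K : Type*} [Field K] {τ 𝓔 : Type*} [Ring 𝓔] [Algebra K 𝓔]
    {E : (τ → K) → 𝓔} (e : 𝓔) (hE : PolyFun E) : PolyFun (fun t => e * E t) := by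
  intro Λ
  obtain ⟨p, hp⟩ := hE (Λ ∘ₗ LinearMap.mulLeft K e)
  exact ⟨p, fun t => by simp [hp]⟩

theorem PolyFun.coord_smul {K : Type*} [Field K] {τ 𝓔 : Type*} [Ring 𝓔] [Algebra K 𝓔]
    {E : (τ → K) → 𝓔} (i : τ) (hE : PolyFun E) : PolyFun (fun t => t i • E t) := by
  intro Λ
  obtain ⟨p, hp⟩ := hE Λ
  exact ⟨MvPolynomial.X i * p, fun t => by simp [hp]⟩

theorem PolyFun.const {K : Type*} [Field K] {τ 𝓔 : Type*} [Ring 𝓔] [Algebra K 𝓔]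
    (e : 𝓔) : PolyFun (fun _ : τ → K => e) := by
  intro Λ
  exact ⟨MvPolynomial.C (Λ e), fun t => by simp⟩

/-- Functions whose left multiplication preserves polynomial functions. -/
def polySub (K : Type*) [Field K] (τ 𝓔 : Type*) [Ring 𝓔] [Algebra K 𝓔] :
    Subalgebra K ((τ → K) → 𝓔) where
  carrier := {E | ∀ H, PolyFun H → PolyFun (E * H)}
  mul_mem' := by
    intro a b ha hb H hH
    rw [mul_assoc]
    exact ha _ (hb _ hH)
  add_mem' := by
    intro a b ha hb H hH
    rw [add_mul]
    exact (ha _ hH).add (hb _ hH)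
  algebraMap_mem' := by
    intro r H hH
    exact hH.const_mul (algebraMap K 𝓔 r)

theorem polySub.polyFun {K : Type*} [Field K] {τ 𝓔 : Type*} [Ring 𝓔] [Algebra K 𝓔]
    {E : (τ → K) → 𝓔} (hE : E ∈ polySub K τ 𝓔) : PolyFun E := by
  have := hE 1 (PolyFun.const (1 : 𝓔))
  rwa [mul_one] at this

theorem polySub.coord {K : Type*} [Field K] {τ 𝓔 : Type*} [Ring 𝓔] [Algebra K 𝓔]
    (i : τ) (e : 𝓔) : (fun t : τ → K => t i • e) ∈ polySub K τ 𝓔 := by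
  intro H hH
  have := (hH.const_mul e).coord_smul i
  refine (congrArg PolyFun ?_).mpr this
  funext t
  simp

theorem polySub.mlEval {K : Type*} [Field K] {τ 𝓔 : Type*} [Ring 𝓔] [Algebra K 𝓔] {m : ℕ}
    (c : Equiv.Perm (Fin m) → K) (T : Fin m → (τ → K) → 𝓔) (h : ∀ i, T i ∈ polySub K τ 𝓔) :
    mlEval c T ∈ polySub K τ 𝓔 := by
  unfold _root_.mlEval
  refine Subalgebra.sum_mem _ fun σ _ => Subalgebra.smul_mem _ ?_ _
  refine Subalgebra.list_prod_mem _ fun x hx => ?_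
  rw [List.mem_ofFn] at hx
  obtain ⟨i, rfl⟩ := hx
  exact h _

/-! ### The action of `D` on itself -/

theorem density {F K D : Type*} [Field F] [DivisionRing D] [Algebra F D] [Field K]
    [Algebra F K] [Module K D] [IsScalarTower F K D] [SMulCommClass D K D]
    (hK : ∀ y : D, (∀ (k : K) (x : D), (k • x) * y = k • (x * y)) →
      ∃ k : K, ∀ x : D, x * y = k • x)
    (f : Module.End K D) (s : Finset D) :
    ∃ l : D →₀ K, ∀ x ∈ s, (l.sum fun a k => k • Algebra.lsmul F K D a) x = f x := by
  let L : D →ₐ[F] Module.End K D := Algebra.lsmul F K D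
  let R : Subalgebra K (Module.End K D) := Algebra.adjoin K (Set.range L)
  have hL : ∀ a, L a ∈ R := fun a => Algebra.subset_adjoin ⟨a, rfl⟩
  have hsimple : IsSimpleModule R D := by
    rw [isSimpleModule_iff_toSpanSingleton_surjective]
    refine ⟨inferInstance, fun x hx y => ⟨⟨L (y * x⁻¹), hL _⟩, ?_⟩⟩
    change y * x⁻¹ * x = y
    rw [mul_assoc, inv_mul_cancel₀ hx, mul_one]
  obtain ⟨r, hr⟩ := jacobson_density (R := R) (M := D)
    { toFun := f
      map_add' := map_add f
      map_smul' := by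
        intro φ x
        change f (φ x) = φ (f x)
        have h1 : ∀ x, φ x = x * φ 1 := by
          intro x
          have := φ.map_smul ⟨L x, hL x⟩ (1 : D)
          change φ (x * 1) = x * φ 1 at this
          rwa [mul_one] at this
        have h2 : ∀ (k : K) x, φ (k • x) = k • φ x := by
          intro k x
          have := φ.map_smul (algebraMap K R k) x
          exact this
        obtain ⟨k, hk⟩ := hK (φ 1) (fun k x => by rw [← h1, ← h1, h2])
        rw [h1 x, hk x, map_smul, h1 (f x), hk (f x)] } s
  have hspan : (r : Module.End K D) ∈ Submodule.span K (Set.range L) := by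
    have h1 : (r : Module.End K D) ∈ Subalgebra.toSubmodule R := r.2
    rw [Algebra.adjoin_eq_span] at h1
    have h2 : (Submonoid.closure (Set.range L) : Set (Module.End K D)) = Set.range L := by
      have := Submonoid.closure_eq (MonoidHom.mrange (L : D →* Module.End K D))
      rw [MonoidHom.coe_mrange] at this
      exact congrArg (fun S : Submonoid (Module.End K D) => (S : Set (Module.End K D))) this
    rwa [h2] at h1
  obtain ⟨l, hl⟩ := Finsupp.mem_span_range_iff_exists_finsupp.mp hspan
  refine ⟨l, fun x hx => ?_⟩
  have := hr x hx
  change f x = (r : Module.End K D) x at this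
  rw [this, ← hl]

theorem rank_le_of_alg {F K D : Type*} [Field F] [Infinite F] [DivisionRing D] [Algebra F D]
    [Field K] [Algebra F K] [Module K D] [IsScalarTower F K D] [SMulCommClass D K D]
    (hK : ∀ y : D, (∀ (k : K) (x : D), (k • x) * y = k • (x * y)) →
      ∃ k : K, ∀ x : D, x * y = k • x)
    {m : ℕ} (c : Equiv.Perm (Fin m) → F)
    (hf : ¬ ∀ T : Fin m → Matrix (Fin 2) (Fin 2) F, ∃ a : F,
      mlEval c T = a • (1 : Matrix (Fin 2) (Fin 2) F))
    (d : ℕ)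
    (halg : ∀ a : Fin m → D,
      ∃ p : Polynomial F, p ≠ 0 ∧ p.natDegree ≤ d ∧
        Polynomial.aeval (mlEval c a) p = 0) :
    Module.rank K D ≤ d := by
  classical
  by_contra hlt
  have hm : 0 < m := by
    rcases Nat.eq_zero_or_pos m with rfl | h
    · exfalso
      apply hf
      intro T
      exact ⟨c 1, by simp [mlEval, Subsingleton.elim _ (1 : Equiv.Perm (Fin 0))]⟩
    · exact h
  have : Infinite K := Infinite.of_injective _ (algebraMap F K).injective
  let c' : Equiv.Perm (Fin m) → K := fun σ => algebraMap F K (c σ)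
  have hf' : ¬ ∀ T : Fin m → Matrix (Fin 2) (Fin 2) K, ∃ a : K,
      mlEval c' T = a • (1 : Matrix (Fin 2) (Fin 2) K) := by
    intro h
    apply hf
    intro T
    let φ : Matrix (Fin 2) (Fin 2) F →ₐ[F] Matrix (Fin 2) (Fin 2) K :=
      AlgHom.mapMatrix (Algebra.ofId F K)
    obtain ⟨a, ha⟩ := h (fun i => φ (T i))
    rw [mlEval_tower, ← mlEval_map] at ha
    have hij : ∀ i j, algebraMap F K (mlEval c T i j) = (a • (1 : Matrix (Fin 2) (Fin 2) K)) i j :=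
      fun i j => congrFun (congrFun ha i) j
    have inj := (algebraMap F K).injective
    refine ⟨mlEval c T 0 0, ?_⟩
    have e00 := hij 0 0
    have e11 := hij 1 1
    have e01 := hij 0 1
    have e10 := hij 1 0
    simp at e00 e11 e01 e10
    have e : mlEval c T 1 1 = mlEval c T 0 0 := inj (e11.trans e00.symm)
    ext i j
    fin_cases i <;> fin_cases j <;> simp [e01, e10, e]
  obtain ⟨ι, _, _, A, hcard, hA⟩ := exists_good hm c' hf' (d + 1)
  obtain ⟨v, hv⟩ : ∃ v : ι → D, LinearIndependent K v := by
    have h1 : ((d + 1 : ℕ) : Cardinal) ≤ Module.rank K D := by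
      rw [not_le] at hlt
      rw [Nat.cast_succ]
      exact Order.succ_le_of_lt hlt |>.trans' (by simp)
    obtain ⟨s, hs⟩ := le_rank_iff_exists_linearIndependent_finset.mp h1
    have h2 : Fintype.card ι = Fintype.card s := by rw [hcard, Fintype.card_coe, hs.1]
    let e := Fintype.equivOfCardEq h2
    exact ⟨fun i => e i, hs.2.comp e e.injective⟩
  have hext : ∀ M : Matrix ι ι K, ∃ f : Module.End K D, ∀ j, f (v j) = ∑ l, M l j • v l := by
    intro M
    obtain ⟨g, hg⟩ := (LinearMap.exists_extend
      ((Fintype.linearCombination K v) ∘ₗ (Matrix.toLin' M) ∘ₗ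
        (Finsupp.linearEquivFunOnFinite K K ι).toLinearMap ∘ₗ hv.repr))
    refine ⟨g, fun j => ?_⟩
    have hmem : v j ∈ Submodule.span K (Set.range v) := Submodule.subset_span ⟨j, rfl⟩
    have := LinearMap.congr_fun hg ⟨v j, hmem⟩
    refine this.trans ?_
    simp only [LinearMap.comp_apply, LinearEquiv.coe_coe]
    rw [hv.repr_eq_single j ⟨v j, hmem⟩ rfl]
    simp [Fintype.linearCombination_apply, Finsupp.linearEquivFunOnFinite_single]
  choose f hfA using fun i => hext (A i)
  choose l hl using fun i => density (F := F) hK (f i) (Finset.univ.image v)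
  let L : D →ₐ[F] Module.End K D := Algebra.lsmul F K D
  let E : Fin m → ((Fin m × D) → K) → Module.End K D := fun i t =>
    ∑ a ∈ (l i).support, t (i, a) • L a
  have hE : ∀ i, E i ∈ polySub K (Fin m × D) (Module.End K D) := by
    intro i
    have : E i = ∑ a ∈ (l i).support, fun t => t (i, a) • L a := by
      funext t; simp [E]
    rw [this]
    exact Subalgebra.sum_mem _ fun a _ => polySub.coord _ _
  have hG := polySub.mlEval c' E hE
  set G := mlEval c' E with hGdef
  have hGt : ∀ t, G t = mlEval c' (fun i => E i t) := fun t =>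
    mlEval_map c' (Pi.evalAlgHom K (fun _ : (Fin m × D → K) => Module.End K D) t) E
  let t0 : Fin m × D → K := fun x => l x.1 x.2
  let S : Subalgebra K (Module.End K D × Matrix ι ι K) :=
    { carrier := {x | ∀ j, x.1 (v j) = ∑ r, x.2 r j • v r}
      mul_mem' := by
        intro x y hx hy j
        simp only [Set.mem_ofPred_eq] at hx hy ⊢
        rw [Prod.fst_mul, Module.End.mul_apply, hy, map_sum, Prod.snd_mul]
        simp only [map_smul, hx, Finset.smul_sum, Matrix.mul_apply, Finset.sum_smul, smul_smul]
        rw [Finset.sum_comm]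
        simp only [mul_comm]
      add_mem' := by
        intro x y hx hy j
        simp only [Set.mem_ofPred_eq] at hx hy ⊢
        simp [hx, hy, add_smul, Finset.sum_add_distrib]
      algebraMap_mem' := by
        intro r j
        simp [Algebra.algebraMap_eq_smul_one, Matrix.one_apply] }
  have hS0 : ∀ i, (E i t0, A i) ∈ S := by
    intro i j
    have := hl i (v j) (Finset.mem_image_of_mem _ (Finset.mem_univ _))
    rw [hfA] at this
    exact this
  have hSf : (G t0, mlEval c' A) ∈ S := by
    have h := mlEval_map (R := S) c' S.val (fun i => (⟨(E i t0, A i), hS0 i⟩ : S))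
    have h1 := mlEval_map c' (AlgHom.fst K (Module.End K D) (Matrix ι ι K))
      (fun i => (E i t0, A i))
    have h2 := mlEval_map c' (AlgHom.snd K (Module.End K D) (Matrix ι ι K))
      (fun i => (E i t0, A i))
    have h3 : (G t0, mlEval c' A) = mlEval c' (fun i => (E i t0, A i)) := by
      rw [hGt]
      exact Prod.ext h1.symm h2.symm
    rw [h3]
    exact h ▸ Subtype.property _
  have hSq : ∀ q : Polynomial K,
      (Polynomial.aeval (G t0) q, Polynomial.aeval (mlEval c' A) q) ∈ S := by
    intro q
    have h1 := Polynomial.aeval_algHom_apply (AlgHom.fst K (Module.End K D) (Matrix ι ι K))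
      (G t0, mlEval c' A) q
    have h2 := Polynomial.aeval_algHom_apply (AlgHom.snd K (Module.End K D) (Matrix ι ι K))
      (G t0, mlEval c' A) q
    have h3 := Polynomial.aeval_algHom_apply S.val ⟨_, hSf⟩ q
    have h4 : (Polynomial.aeval (G t0) q, Polynomial.aeval (mlEval c' A) q) =
      Polynomial.aeval (G t0, mlEval c' A) q := Prod.ext h1 h2
    rw [h4]
    exact h3 ▸ Subtype.property _
  have hkill : ∀ q : Polynomial K, Polynomial.aeval (G t0) q = 0 →
      Polynomial.aeval (mlEval c' A) q = 0 := by
    intro q hq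
    ext r j
    have := hSq q j
    simp only [hq, LinearMap.zero_apply] at this
    exact Fintype.linearIndependent_iff.mp hv _ this.symm r
  have hind : LinearIndependent K (fun s : Fin (d + 1) => G t0 ^ (s : ℕ)) := by
    rw [Fintype.linearIndependent_iff]
    intro g hg s
    by_contra hs
    let q : Polynomial K := ∑ i : Fin (d + 1), Polynomial.monomial (i : ℕ) (g i)
    have hcoef : q.coeff s = g s := by
      simp [q, Polynomial.coeff_monomial, Fin.val_inj]
    have hq0 : q ≠ 0 := by
      intro h
      rw [h] at hcoef
      exact hs hcoef.symm
    have hqd : q.natDegree ≤ d := by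
      refine Polynomial.natDegree_sum_le_of_forall_le _ _ fun i _ => ?_
      exact (Polynomial.natDegree_monomial_le _).trans (Nat.lt_succ_iff.mp i.2)
    have hqz : Polynomial.aeval (G t0) q = 0 := by
      rw [← hg]
      simp [q, Polynomial.aeval_monomial, Algebra.smul_def]
    have := hA q hq0 (hkill q hqz)
    omega
  obtain ⟨Λ, hΛ⟩ : ∃ Λ : Fin (d + 1) → (Module.End K D →ₗ[K] K),
      ∀ r s : Fin (d + 1), Λ r (G t0 ^ (s : ℕ)) = if r = s then 1 else 0 := by
    obtain ⟨g, hg⟩ := LinearMap.exists_leftInverse_of_injective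
      (Fintype.linearCombination K (fun s : Fin (d + 1) => G t0 ^ (s : ℕ)))
      (LinearMap.ker_eq_bot.mpr hind.fintypeLinearCombination_injective)
    refine ⟨fun r => LinearMap.proj r ∘ₗ g, fun r s => ?_⟩
    have := LinearMap.congr_fun hg (Pi.single s 1)
    simp only [LinearMap.comp_apply, Fintype.linearCombination_apply_single, one_smul,
      LinearMap.id_apply] at this
    simp [this, Pi.single_apply]
  choose p hp using fun (r s : Fin (d + 1)) =>
    (polySub.polyFun (Subalgebra.pow_mem _ hG (s : ℕ))) (Λ r)
  let Δ : MvPolynomial (Fin m × D) K := (Matrix.of p).det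
  have hΔ : ∀ t, MvPolynomial.eval t Δ =
      (Matrix.of fun r s : Fin (d + 1) => Λ r (G t ^ (s : ℕ))).det := by
    intro t
    rw [RingHom.map_det]
    congr 1
    ext r s
    exact hp r s t
  have hΔ0 : Δ = 0 := by
    refine MvPolynomial.funext_set (fun _ => Set.range (algebraMap F K))
      (fun _ => Set.infinite_range_of_injective (algebraMap F K).injective) ?_
    intro t ht
    have : ∀ x, ∃ y, algebraMap F K y = t x := fun x => ht x trivial
    choose θ hθ using this
    rw [hΔ, map_zero]
    let a : Fin m → D := fun i => ∑ x ∈ (l i).support, θ (i, x) • x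
    have hEt : ∀ i, E i t = L (a i) := by
      intro i
      simp only [E, a, map_sum, map_smul, ← hθ, algebraMap_smul]
    have hGa : G t = L (mlEval c a) := by
      rw [hGt, mlEval_map, mlEval_tower]
      simp only [hEt]
    obtain ⟨q, hq0, hqd, hq⟩ := halg a
    have hq' : Polynomial.aeval (G t) q = 0 := by
      rw [hGa, Polynomial.aeval_algHom_apply, hq, map_zero]
    rw [Polynomial.aeval_eq_sum_range' (Nat.lt_succ_of_le hqd), Finset.sum_range] at hq'
    rw [← Matrix.exists_mulVec_eq_zero_iff]
    refine ⟨fun s => algebraMap F K (q.coeff s), ?_, ?_⟩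
    · intro h
      apply hq0
      ext n
      by_cases hn : n < d + 1
      · have := congrFun h ⟨n, hn⟩
        simpa using this
      · rw [Polynomial.coeff_eq_zero_of_natDegree_lt (by omega)]; simp
    · funext r
      have := congrArg (Λ r) hq'
      rw [map_zero, map_sum] at this
      simp only [Matrix.mulVec, dotProduct, Matrix.of_apply, Pi.zero_apply]
      rw [← this]
      refine Finset.sum_congr rfl fun s _ => ?_
      rw [← algebraMap_smul K (q.coeff s), map_smul, smul_eq_mul, mul_comm]
  have h1 := hΔ t0
  rw [hΔ0, map_zero] at h1
  have h2 : (Matrix.of fun r s : Fin (d + 1) => Λ r (G t0 ^ (s : ℕ))) = 1 := by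
    ext r s
    rw [Matrix.of_apply, hΛ, Matrix.one_apply]
  rw [h2, Matrix.det_one] at h1
  exact zero_ne_one h1

/-! ### Injectivity of `D ⊗ K → End D` -/

theorem inj_aux {F K D : Type*} [Field F] [DivisionRing D] [Algebra F D]
    [Field K] [Algebra F K] [Module K D] [IsScalarTower F K D] [SMulCommClass D K D]
    (hcenter : Set.range (algebraMap F D) = Set.center D)
    {J : Type*} (e : J → K) (he : LinearIndependent F e) (s : Finset J) :
    ∀ (a : J → D), (∀ x, ∑ i ∈ s, e i • (a i * x) = 0) → ∀ i ∈ s, a i = 0 := by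
  classical
  induction s using Finset.induction_on with
  | empty => intro a _ i hi; simp at hi
  | insert i0 s hi0 ih =>
    intro a ha
    by_cases h0 : a i0 = 0
    · have := ih a (fun x => by simpa [Finset.sum_insert hi0, h0] using ha x)
      intro i hi
      rcases Finset.mem_insert.mp hi with rfl | hi
      · exact h0
      · exact this i hi
    · exfalso
      let b : J → D := fun i => (a i0)⁻¹ * a i
      have hb0 : b i0 = 1 := inv_mul_cancel₀ h0
      have smul_comm' : ∀ (y : D) (k : K) (x : D), y * (k • x) = k • (y * x) :=
        fun y k x => smul_comm y k x
      have hb : ∀ x, ∑ i ∈ insert i0 s, e i • (b i * x) = 0 := by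
        intro x
        have := congrArg (fun z => (a i0)⁻¹ * z) (ha x)
        simp only [Finset.mul_sum, mul_zero, smul_comm'] at this
        rw [← this]
        exact Finset.sum_congr rfl fun i _ => by simp only [b, mul_assoc]
      have hcomm : ∀ y, ∀ i ∈ s, y * b i - b i * y = 0 := by
        intro y
        apply ih
        intro x
        have h1 := congrArg (fun z => y * z) (hb x)
        have h2 := hb (y * x)
        simp only [Finset.mul_sum, mul_zero, smul_comm'] at h1
        have h3 : ∑ i ∈ insert i0 s, e i • ((y * b i - b i * y) * x) = 0 := by
          rw [← sub_zero (0 : D)]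
          nth_rw 1 [← h1]
          rw [← h2, ← Finset.sum_sub_distrib]
          exact Finset.sum_congr rfl fun i _ => by rw [← smul_sub, sub_mul, mul_assoc y (b i) x,
            mul_assoc (b i) y x]
        simpa [Finset.sum_insert hi0, hb0] using h3
      have hcen : ∀ i ∈ insert i0 s, ∃ β : F, algebraMap F D β = b i := by
        intro i hi
        rcases Finset.mem_insert.mp hi with rfl | hi
        · exact ⟨1, by rw [map_one, hb0]⟩
        · have : b i ∈ Set.center D := by
            rw [Semigroup.mem_center_iff]
            intro y
            exact sub_eq_zero.mp (hcomm y i hi)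
          rw [← hcenter] at this
          exact this
      choose! β hβ using hcen
      have h1 := hb 1
      have h2 : (∑ i ∈ insert i0 s, β i • e i) • (1 : D) = 0 := by
        rw [← h1, Finset.sum_smul]
        refine Finset.sum_congr rfl fun i hi => ?_
        rw [← hβ i hi, mul_one, Algebra.algebraMap_eq_smul_one, smul_assoc, smul_comm]
      have h3 : ∑ i ∈ insert i0 s, β i • e i = 0 := by
        rcases smul_eq_zero.mp h2 with h | h
        · exact h
        · exact absurd h one_ne_zero
      have h4 := linearIndependent_iff'.mp he _ β h3 i0 (Finset.mem_insert_self _ _)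
      have h5 := hβ i0 (Finset.mem_insert_self _ _)
      rw [h4, hb0, map_zero] at h5
      exact zero_ne_one h5

theorem rank_sq {F K D : Type*} [Field F] [DivisionRing D] [Algebra F D]
    [Field K] [Algebra F K] [Module K D] [IsScalarTower F K D] [SMulCommClass D K D]
    (hcenter : Set.range (algebraMap F D) = Set.center D) (d : ℕ)
    (hd : Module.rank K D ≤ d) : Module.rank F D ≤ (d ^ 2 : ℕ) := by
  classical
  have hfin : Module.Finite K D :=
    Module.rank_lt_aleph0_iff.mp (hd.trans_lt (Cardinal.natCast_lt_aleph0))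
  have hfr : Module.finrank K D ≤ d := Module.finrank_le_of_rank_le hd
  apply rank_le
  intro s hs
  have hind : LinearIndependent K (fun i : s => Algebra.lsmul F K D (i : D)) := by
    rw [Fintype.linearIndependent_iff]
    intro g hg
    let e := Module.Basis.ofVectorSpace F K
    let J := Finset.univ.biUnion fun i : s => (e.repr (g i)).support
    have hgJ : ∀ i, g i = ∑ j ∈ J, e.repr (g i) j • e j := by
      intro i
      conv_lhs => rw [← e.linearCombination_repr (g i), Finsupp.linearCombination_apply]
      refine Finsupp.sum_of_support_subset _ ?_ _ (by simp)
      exact Finset.subset_biUnion_of_mem (fun i : s => (e.repr (g i)).support) (Finset.mem_univ i)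
    have key := inj_aux hcenter e e.linearIndependent J
      (fun j => ∑ i : s, e.repr (g i) j • (i : D)) (fun x => by
        have h1 := LinearMap.congr_fun hg x
        simp only [LinearMap.sum_apply, LinearMap.smul_apply, LinearMap.zero_apply,
          Algebra.lsmul_coe, smul_eq_mul] at h1
        rw [← h1]
        simp only [Finset.sum_mul, Finset.smul_sum]
        rw [Finset.sum_comm]
        refine Finset.sum_congr rfl fun i _ => ?_
        conv_rhs => rw [hgJ i, Finset.sum_smul]
        refine Finset.sum_congr rfl fun j _ => ?_
        rw [smul_assoc, smul_mul_assoc, smul_comm])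
    intro i
    rw [hgJ i]
    refine Finset.sum_eq_zero fun j hj => ?_
    rw [Fintype.linearIndependent_iff.mp hs _ (key j hj) i, zero_smul]
  have h1 := hind.fintype_card_le_finrank
  rw [Fintype.card_coe, Module.finrank_linearMap] at h1
  calc s.card ≤ _ := h1
    _ ≤ d * d := Nat.mul_le_mul hfr hfr
    _ = d ^ 2 := (sq d).symm

/-! ### A maximal commutative subfield -/

theorem exists_maxComm {M : Type*} [Mul M] : ∃ s : Set M, Set.centralizer s = s := by
  obtain ⟨s, hs⟩ := zorn_subset {s : Set M | ∀ x ∈ s, ∀ y ∈ s, x * y = y * x} (by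
    intro C hC hchain
    refine ⟨⋃₀ C, ?_, fun t ht => Set.subset_sUnion_of_mem ht⟩
    rintro x ⟨t, ht, hx⟩ y ⟨t', ht', hy⟩
    rcases hchain.total ht ht' with h | h
    · exact hC ht' x (h hx) y hy
    · exact hC ht x hx y (h hy))
  refine ⟨s, Set.Subset.antisymm ?_ ?_⟩
  · intro y hy
    have hmem : insert y s ∈ {s : Set M | ∀ x ∈ s, ∀ y ∈ s, x * y = y * x} := by
      rintro a (rfl | ha) b (rfl | hb)
      · rfl
      · exact (hy b hb).symm
      · exact hy a ha
      · exact hs.prop a ha b hb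
    exact hs.le_of_ge hmem (Set.subset_insert _ _) (Set.mem_insert _ _)
  · intro x hx y hy
    exact hs.prop y hy x hx

theorem exists_maxField.{u, w} (F : Type u) (D : Type w) [Field F] [DivisionRing D] [Algebra F D] :
    ∃ (K : Type w) (_ : Field K) (_ : Algebra F K) (ρ : K →ₐ[F] Dᵐᵒᵖ),
      ∀ y : Dᵐᵒᵖ, (∀ k, ρ k * y = y * ρ k) → ∃ k, ρ k = y := by
  obtain ⟨s, hs⟩ := exists_maxComm (M := Dᵐᵒᵖ)
  let S := Subalgebra.centralizer F s
  have hS : ∀ x, x ∈ S ↔ x ∈ s := by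
    intro x
    conv_rhs => rw [← hs]
    exact Iff.rfl
  have hfield : IsField S :=
    { exists_pair_ne := ⟨0, 1, zero_ne_one⟩
      mul_comm := by
        rintro ⟨x, hx⟩ ⟨y, hy⟩
        apply Subtype.ext
        exact hy x ((hS x).mp hx)
      mul_inv_cancel := by
        rintro ⟨x, hx⟩ hx0
        have hx0' : x ≠ 0 := fun h => hx0 (Subtype.ext h)
        refine ⟨⟨x⁻¹, Set.inv_mem_centralizer₀ hx⟩, Subtype.ext ?_⟩
        exact mul_inv_cancel₀ hx0' }
  refine ⟨S, hfield.toField, S.algebra, S.val, ?_⟩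
  intro y hy
  have : y ∈ S := by
    intro x hx
    exact hy ⟨x, (hS x).mpr hx⟩
  exact ⟨⟨y, this⟩, rfl⟩

/-- Let `D` be a division ring whose center `F` is infinite, let `f(x_1,…,x_m)` be a
multilinear polynomial over `F` that is non-central over `M_2(F)`, and let `d > 0`.
If for all nonzero `a_1,…,a_m ∈ D` the value `f(a_1,…,a_m)` is algebraic over `F` of
degree at most `d`, then `dim_F D ≤ d²`. -/
theorem dim_le_sq_of_multilinear_algebraic_bounded
    {F D : Type*} [Field F] [Infinite F] [DivisionRing D] [Algebra F D]
    (hcenter : Set.range (algebraMap F D) = Set.center D)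
    {m : ℕ} (c : Equiv.Perm (Fin m) → F)
    (hf : ¬ ∀ T : Fin m → Matrix (Fin 2) (Fin 2) F, ∃ a : F,
      mlEval c T = a • (1 : Matrix (Fin 2) (Fin 2) F))
    (d : ℕ) (hd : 0 < d)
    (halg : ∀ a : Fin m → D, (∀ i, a i ≠ 0) →
      ∃ p : Polynomial F, p ≠ 0 ∧ p.natDegree ≤ d ∧
        Polynomial.aeval (mlEval c a) p = 0) :
    Module.rank F D ≤ (d ^ 2 : ℕ) := by
  have halg' : ∀ a : Fin m → D, ∃ p : Polynomial F, p ≠ 0 ∧ p.natDegree ≤ d ∧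
      Polynomial.aeval (mlEval c a) p = 0 := by
    intro a
    by_cases h : ∀ i, a i ≠ 0
    · exact halg a h
    · push Not at h
      obtain ⟨i, hi⟩ := h
      refine ⟨Polynomial.X, Polynomial.X_ne_zero, ?_, ?_⟩
      · rw [Polynomial.natDegree_X]; exact hd
      · rw [Polynomial.aeval_X, mlEval_zero_of c a i hi]
  obtain ⟨K, _, _, ρ, hρ⟩ := exists_maxField F D
  let _ : Module K D := Module.compHom D (ρ : K →+* Dᵐᵒᵖ)
  have hsm : ∀ (k : K) (x : D), k • x = x * (ρ k).unop := fun _ _ => rfl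
  have : IsScalarTower F K D := ⟨fun r k x => by
    simp only [hsm, map_smul, MulOpposite.unop_smul, mul_smul_comm]⟩
  have : SMulCommClass D K D := ⟨fun a k x => by
    simp only [hsm, smul_eq_mul, mul_assoc]⟩
  refine rank_sq (K := K) hcenter d (rank_le_of_alg (F := F) (K := K) ?_ c hf d halg')
  intro y hy
  obtain ⟨k, hk⟩ := hρ (MulOpposite.op y) (fun k => by
    have := hy k 1
    simp only [hsm, one_mul] at this
    apply MulOpposite.unop_injective
    simp only [MulOpposite.unop_mul, MulOpposite.unop_op]
    exact this.symm)
  refine ⟨k, fun x => ?_⟩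
  rw [hsm, hk, MulOpposite.unop_op]
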